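/- (Step 1 in the proof of the elliptic Gibbons theorem.) Let n ≥ 1 and s ∈ (0,1). Let u ∈ L_{2s} ∩ C²(ℝⁿ) be a uniformly continuous solution of (−Δ)^s u(x) − Δu(x) = g(x, u(x)) on ℝⁿ with |u(x)| ≤ 1 for all x and u(x', x_n) → ±1 as x_n → ±∞ uniformly in x' ∈ ℝ^{n−1}. Suppose g : ℝⁿ × ℝ → ℝ is continuous, there exists γ > 0 such that for each fixed x the map u ↦ g(x,u) is nonincreasing on [−1, −1+γ] and on [1−γ, 1], and g(x', x_n, u) ≤ g(x', x̂_n, u) whenever x_n ≤ x̂_n. Let λ > 0 be such that |u(x', x_n)| ≥ 1 − γ whenever |x_n| ≥ λ (such λ exists by the uniform limits). Then for every τ ≥ 2λ and every x = (x', x_n) ∈ ℝⁿ, one has u(x', x_n) ≤ u(x', x_n + τ). -/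

import Mathlib

open MeasureTheory Filter Set

noncomputable section

/-- `ℝⁿ` as a Euclidean space. -/
abbrev En (n : ℕ) : Type := EuclideanSpace ℝ (Fin n)

/-- `HasFracLap n s Cns u x L` says that the principal value defining the fractional
Laplacian `(-Δ)ˢ u (x) = Cns · P.V. ∫ (u x - u y)/|x-y|^{n+2s} dy` exists and equals `L`. -/
def HasFracLap (n : ℕ) (s Cns : ℝ) (u : En n → ℝ) (x : En n) (L : ℝ) : Prop :=
  Tendsto
    (fun ε : ℝ =>
      Cns * ∫ y in {y : En n | ε ≤ ‖x - y‖}, (u x - u y) / ‖x - y‖ ^ ((n : ℝ) + 2 * s))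
    (nhdsWithin 0 (Set.Ioi 0)) (nhds L)

/-- The classical Laplacian `Δu(x) = ∑ ∂²u/∂xᵢ²`. -/
def lap {n : ℕ} (u : En n → ℝ) (x : En n) : ℝ :=
  ∑ i : Fin n, iteratedFDeriv ℝ 2 u x fun _ => EuclideanSpace.single i (1 : ℝ)

/-- Membership in the tail space `L_{2s}`. -/
def MemL2s (n : ℕ) (s : ℝ) (u : En n → ℝ) : Prop :=
  LocallyIntegrable u volume ∧
    Integrable (fun x : En n => u x / (1 + ‖x‖ ^ ((n : ℝ) + 2 * s))) volume

/-- The Marchaud fractional time derivative of order `α ∈ (0,1)`; for `α = 1` it is the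
classical derivative. -/
def marchaud (α : ℝ) (v : ℝ → ℝ) (t : ℝ) : ℝ :=
  if α = 1 then deriv v t
  else (α / Real.Gamma (1 - α)) * ∫ τ in Set.Iio t, (v t - v τ) / (t - τ) ^ (1 + α)

/-- Membership in the space `𝓛⁻_α(ℝ)`. -/
def MemLminus (α : ℝ) (v : ℝ → ℝ) : Prop :=
  LocallyIntegrable v volume ∧
    ∀ t : ℝ, IntegrableOn (fun τ : ℝ => v τ / (1 + |τ| ^ (1 + α))) (Set.Iio t) volume

/-- Width of a set in the direction of the coordinate `i₀`. -/
def widthLast {n : ℕ} (i₀ : Fin n) (Ω : Set (En n)) : ℝ :=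
  sSup ((fun x : En n => x i₀) '' Ω) - sInf ((fun x : En n => x i₀) '' Ω)

/-- The unit vector in the direction of the coordinate `i₀`. -/
def eDir {n : ℕ} (i₀ : Fin n) : En n := EuclideanSpace.single i₀ (1 : ℝ)

/-- The singular kernel `‖z‖^{-(n+2s)}`, tamed by `min 1 ‖z‖²`, is integrable. -/
theorem integrable_min_one_norm_sq_div_rpow {n : ℕ} (hn : 1 ≤ n) {s : ℝ}
    (hs : s ∈ Set.Ioo (0 : ℝ) 1) :
    Integrable (fun z : En n => min 1 (‖z‖ ^ 2) / ‖z‖ ^ ((n : ℝ) + 2 * s)) volume := by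
  have : Nonempty (Fin n) := ⟨⟨0, hn⟩⟩
  have : Nontrivial (En n) := inferInstance
  rw [integrable_fun_norm_addHaar volume
    (f := fun r : ℝ => min 1 (r ^ 2) / r ^ ((n : ℝ) + 2 * s)), finrank_euclideanSpace_fin]
  have hcast : ((n - 1 : ℕ) : ℝ) = n - 1 := by push_cast [hn]; ring
  rw [← Set.Ioo_union_Ici_eq_Ioi zero_lt_one]
  refine IntegrableOn.union ?_ ?_
  · have h := (intervalIntegral.integrableOn_Ioo_rpow_iff (s := 1 - 2 * s) zero_lt_one).2
      (by linarith [hs.2])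
    refine h.congr_fun (fun r hr => ?_) measurableSet_Ioo
    have hr0 : 0 < r := hr.1
    have hmin : min 1 (r ^ 2) = r ^ 2 := min_eq_right (by nlinarith [hr.1, hr.2])
    simp only [smul_eq_mul, hmin]
    rw [← Real.rpow_natCast r (n - 1), ← Real.rpow_natCast r 2, ← Real.rpow_sub hr0,
      ← Real.rpow_add hr0, hcast]
    congr 1
    push_cast
    ring
  · have h := (integrableOn_Ioi_rpow_of_lt (a := -1 - 2 * s) (by linarith [hs.1]) zero_lt_one)
    rw [integrableOn_Ici_iff_integrableOn_Ioi]
    refine h.congr_fun (fun r hr => ?_) measurableSet_Ioi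
    have hr1 : 1 < r := hr
    have hr0 : 0 < r := by linarith
    have hmin : min 1 (r ^ 2) = 1 := min_eq_left (by nlinarith)
    simp only [smul_eq_mul, hmin]
    rw [← Real.rpow_natCast r (n - 1), one_div, ← Real.rpow_neg hr0.le,
      ← Real.rpow_add hr0, hcast]
    congr 1
    ring

theorem measurableSet_le_norm {n : ℕ} (δ : ℝ) : MeasurableSet {z : En n | δ ≤ ‖z‖} :=
  measurableSet_le measurable_const measurable_norm

/-- Away from the origin, a bounded continuous function is integrable against the kernel. -/
theorem integrableOn_div_rpow_norm {n : ℕ} (hn : 1 ≤ n) {s : ℝ}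
    (hs : s ∈ Set.Ioo (0 : ℝ) 1) {f : En n → ℝ} (hf : Continuous f) {C : ℝ}
    (hC : ∀ z, |f z| ≤ C) {δ : ℝ} (hδ : 0 < δ) :
    IntegrableOn (fun z : En n => f z / ‖z‖ ^ ((n : ℝ) + 2 * s)) {z : En n | δ ≤ ‖z‖}
      volume := by
  have hm : 0 < min 1 (δ ^ 2) := lt_min one_pos (by positivity)
  have hC0 : 0 ≤ C := (abs_nonneg _).trans (hC 0)
  refine Integrable.mono'
    (((integrable_min_one_norm_sq_div_rpow hn hs).const_mul (C / min 1 (δ ^ 2))).integrableOn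
      (s := {z : En n | δ ≤ ‖z‖}))
    (by
      refine Measurable.aestronglyMeasurable ?_
      exact hf.measurable.div (measurable_norm.pow_const _)) ?_
  refine (ae_restrict_iff' (measurableSet_le_norm δ)).2 (Eventually.of_forall fun z hz => ?_)
  have hz' : δ ≤ ‖z‖ := hz
  have hzp : 0 < ‖z‖ ^ ((n : ℝ) + 2 * s) := Real.rpow_pos_of_pos (hδ.trans_le hz') _
  have hmono : min 1 (δ ^ 2) ≤ min 1 (‖z‖ ^ 2) :=
    min_le_min le_rfl (pow_le_pow_left₀ hδ.le hz' 2)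
  rw [Real.norm_eq_abs, abs_div, abs_of_pos hzp, ← mul_div_assoc]
  refine div_le_div_of_nonneg_right ((hC z).trans ?_) hzp.le
  rw [div_mul_eq_mul_div, le_div_iff₀ hm]
  exact mul_le_mul_of_nonneg_left hmono hC0

/-- The truncated fractional Laplacian as an integral of symmetric second differences. -/
theorem two_mul_truncated_integral {n : ℕ} (hn : 1 ≤ n) {s : ℝ}
    (hs : s ∈ Set.Ioo (0 : ℝ) 1) {u : En n → ℝ} (hu : Continuous u) {C : ℝ}
    (hC : ∀ z, |u z| ≤ C) (x : En n) {δ : ℝ} (hδ : 0 < δ) :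
    2 * ∫ y in {y : En n | δ ≤ ‖x - y‖}, (u x - u y) / ‖x - y‖ ^ ((n : ℝ) + 2 * s) =
      ∫ z in {z : En n | δ ≤ ‖z‖},
        (2 * u x - u (x + z) - u (x - z)) / ‖z‖ ^ ((n : ℝ) + 2 * s) := by
  have hb : ∀ a b : En n, |u a - u b| ≤ C + C := fun a b =>
    (abs_sub _ _).trans (add_le_add (hC a) (hC b))
  have h1 : ∫ z in {z : En n | δ ≤ ‖z‖}, (u x - u (x + z)) / ‖z‖ ^ ((n : ℝ) + 2 * s) =
      ∫ y in {y : En n | δ ≤ ‖x - y‖}, (u x - u y) / ‖x - y‖ ^ ((n : ℝ) + 2 * s) := by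
    have := (measurePreserving_add_left (volume : Measure (En n)) x).setIntegral_preimage_emb
      (MeasurableEquiv.addLeft x).measurableEmbedding
      (fun y => (u x - u y) / ‖x - y‖ ^ ((n : ℝ) + 2 * s)) {y : En n | δ ≤ ‖x - y‖}
    simpa using this
  have h2 : ∫ z in {z : En n | δ ≤ ‖z‖}, (u x - u (x - z)) / ‖z‖ ^ ((n : ℝ) + 2 * s) =
      ∫ z in {z : En n | δ ≤ ‖z‖}, (u x - u (x + z)) / ‖z‖ ^ ((n : ℝ) + 2 * s) := by
    have := (Measure.measurePreserving_neg (volume : Measure (En n))).setIntegral_preimage_emb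
      (MeasurableEquiv.neg (En n)).measurableEmbedding
      (fun z => (u x - u (x + z)) / ‖z‖ ^ ((n : ℝ) + 2 * s)) {z : En n | δ ≤ ‖z‖}
    simpa [sub_eq_add_neg] using this
  rw [two_mul]
  nth_rewrite 1 [← h1]
  rw [← h1, ← h2]
  nth_rewrite 1 [h2]
  rw [← integral_add
    (integrableOn_div_rpow_norm hn hs (by fun_prop) (fun z => hb x (x + z)) hδ)
    (integrableOn_div_rpow_norm hn hs (by fun_prop) (fun z => hb x (x - z)) hδ)]
  refine integral_congr_ae (Eventually.of_forall fun z => ?_)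
  simp only
  ring

/-- A bound on symmetric second differences bounds the pure second derivative. -/
theorem iteratedFDeriv_two_le_of_second_difference_le {E : Type*} [NormedAddCommGroup E]
    [NormedSpace ℝ E] {w : E → ℝ} (hw : ContDiff ℝ 2 w) (x e : E) {C : ℝ}
    (h : ∀ t : ℝ, w (x + t • e) + w (x - t • e) - 2 * w x ≤ C * t ^ 2) :
    iteratedFDeriv ℝ 2 w x (fun _ => e) ≤ C := by
  by_contra! hlt
  rw [iteratedFDeriv_two_apply] at hlt
  have hd : Differentiable ℝ w := hw.differentiable (by norm_num)
  have hd2 : Differentiable ℝ (fderiv ℝ w) :=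
    (hw.fderiv_right (m := 1) (by norm_num)).differentiable (by norm_num)
  have hl1 : ∀ t : ℝ, HasDerivAt (fun t : ℝ => x + t • e) e t := fun t => by
    simpa using ((hasDerivAt_id t).smul_const e).const_add x
  have hl2 : ∀ t : ℝ, HasDerivAt (fun t : ℝ => x - t • e) (-e) t := fun t => by
    simpa using ((hasDerivAt_id t).smul_const e).const_sub x
  set f : ℝ → ℝ := fun t => w (x + t • e) + w (x - t • e) - C * t ^ 2 with hf
  have hf1 : ∀ t, HasDerivAt f
      (fderiv ℝ w (x + t • e) e - fderiv ℝ w (x - t • e) e - 2 * C * t) t := fun t => by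
    have a1 := (hd (x + t • e)).hasFDerivAt.comp_hasDerivAt t (hl1 t)
    have a2 := (hd (x - t • e)).hasFDerivAt.comp_hasDerivAt t (hl2 t)
    have a3 := ((hasDerivAt_id t).pow 2).const_mul C
    refine ((a1.add a2).sub a3).congr_deriv ?_
    simp
    ring
  have hderiv : deriv f = fun t =>
      fderiv ℝ w (x + t • e) e - fderiv ℝ w (x - t • e) e - 2 * C * t :=
    funext fun t => (hf1 t).deriv
  have hf2 : HasDerivAt (deriv f) (2 * fderiv ℝ (fderiv ℝ w) x e e - 2 * C) 0 := by
    rw [hderiv]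
    have c1 : HasDerivAt (fun t : ℝ => fderiv ℝ w (x + t • e))
        (fderiv ℝ (fderiv ℝ w) (x + (0 : ℝ) • e) e) 0 :=
      (hd2 (x + (0 : ℝ) • e)).hasFDerivAt.comp_hasDerivAt (0 : ℝ) (hl1 0)
    have c2 : HasDerivAt (fun t : ℝ => fderiv ℝ w (x - t • e))
        (fderiv ℝ (fderiv ℝ w) (x - (0 : ℝ) • e) (-e)) 0 :=
      (hd2 (x - (0 : ℝ) • e)).hasFDerivAt.comp_hasDerivAt (0 : ℝ) (hl2 0)
    have b1 := c1.clm_apply (hasDerivAt_const (0 : ℝ) e)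
    have b2 := c2.clm_apply (hasDerivAt_const (0 : ℝ) e)
    have b3 := (hasDerivAt_id (0 : ℝ)).const_mul (2 * C)
    refine ((b1.sub b2).sub b3).congr_deriv ?_
    simp
    ring
  have hmin : IsLocalMin f 0 := isLocalMin_of_deriv_deriv_pos
    (by rw [hf2.deriv]; linarith) (by rw [hderiv]; simp) (hf1 0).continuousAt
  have hconst : f =ᶠ[nhds 0] fun _ => 2 * w x := by
    filter_upwards [hmin] with t ht
    have h0 : f 0 = 2 * w x := by simp [hf]; ring
    have := h t
    rw [h0] at ht
    refine le_antisymm ?_ ht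
    simp only [hf]
    linarith
  have hzero : deriv (deriv f) 0 = 0 := by
    have h1 : deriv f =ᶠ[nhds 0] fun _ => 0 := by simpa using hconst.deriv
    simpa using h1.deriv_eq
  rw [hf2.deriv] at hzero
  linarith

/-- The bounded bump `‖y‖² / (1 + ‖y‖²)` used as a penalization. -/
def bump {n : ℕ} (y : En n) : ℝ := 1 - 1 / (1 + ‖y‖ ^ 2)

theorem continuous_bump {n : ℕ} : Continuous (bump : En n → ℝ) := by
  unfold bump
  refine continuous_const.sub (continuous_const.div (by fun_prop) fun y => ?_)
  positivity

theorem bump_nonneg {n : ℕ} (y : En n) : 0 ≤ bump y := by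
  have : 1 / (1 + ‖y‖ ^ 2) ≤ 1 := by
    rw [div_le_one (by positivity)]
    nlinarith [sq_nonneg ‖y‖]
  unfold bump
  linarith

theorem bump_le_one {n : ℕ} (y : En n) : bump y ≤ 1 := by
  have : 0 ≤ 1 / (1 + ‖y‖ ^ 2) := by positivity
  unfold bump
  linarith

theorem half_le_bump {n : ℕ} {y : En n} (hy : 1 ≤ ‖y‖) : 1 / 2 ≤ bump y := by
  have : 1 / (1 + ‖y‖ ^ 2) ≤ 1 / 2 :=
    one_div_le_one_div_of_le (by norm_num) (by nlinarith)
  unfold bump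
  linarith

theorem bump_second_difference_le {n : ℕ} (a z : En n) :
    bump (a + z) + bump (a - z) - 2 * bump a ≤ 2 * min 1 (‖z‖ ^ 2) := by
  rw [mul_min_of_nonneg _ _ zero_le_two, le_min_iff]
  refine ⟨by linarith [bump_le_one (a + z), bump_le_one (a - z), bump_nonneg a], ?_⟩
  have hpar := parallelogram_law_with_norm ℝ a z
  have key : ∀ p q A Z : ℝ, 0 ≤ p → 0 ≤ q → 0 ≤ A → 0 ≤ Z → p + q = 2 * (A + Z) →
      2 / (1 + A) - 2 * Z ≤ 1 / (1 + p) + 1 / (1 + q) := by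
    intro p q A Z hp hq hA hZ h
    have h1 : 2 / (1 + A + Z) ≤ 1 / (1 + p) + 1 / (1 + q) := by
      rw [div_add_div _ _ (by positivity) (by positivity),
        div_le_div_iff₀ (by positivity) (by positivity)]
      have hA' : A = (p + q) / 2 - Z := by linarith
      subst hA'
      nlinarith [sq_nonneg (p - q)]
    have h2 : 2 / (1 + A) - 2 * Z ≤ 2 / (1 + A + Z) := by
      rw [sub_le_iff_le_add, div_add' _ _ _ (by positivity),
        div_le_div_iff₀ (by positivity) (by positivity)]
      nlinarith [mul_nonneg hA hZ, mul_nonneg hZ hZ, mul_nonneg hA (mul_nonneg hA hZ),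
        mul_nonneg hA (mul_nonneg hZ hZ)]
    exact h2.trans h1
  have := key _ _ _ _ (sq_nonneg ‖a + z‖) (sq_nonneg ‖a - z‖) (sq_nonneg ‖a‖)
    (sq_nonneg ‖z‖) hpar
  have e2 : 2 / (1 + ‖a‖ ^ 2) = 2 * (1 / (1 + ‖a‖ ^ 2)) := by ring
  unfold bump
  linarith

/-- A bounded continuous function comes arbitrarily close to its supremum at a point where it is
touched from above by a function with small second differences. -/
theorem exists_almost_max_second_difference_le {n : ℕ} {w : En n → ℝ} (hw : Continuous w)
    (hbdd : BddAbove (Set.range w)) {ε : ℝ} (hε : 0 < ε) :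
    ∃ x, sSup (Set.range w) - ε / 2 < w x ∧
      ∀ z, w (x + z) + w (x - z) - 2 * w x ≤ 2 * ε * min 1 (‖z‖ ^ 2) := by
  obtain ⟨_, ⟨x₁, rfl⟩, hx₁⟩ := exists_lt_of_lt_csSup (Set.range_nonempty w)
    (sub_lt_self (sSup (Set.range w)) (half_pos hε))
  have hsup : ∀ y, w y ≤ sSup (Set.range w) := fun y => le_csSup hbdd ⟨y, rfl⟩
  have hb0 : bump (0 : En n) = 0 := by simp [bump]
  have hcont : Continuous fun y => w y - ε * bump (y - x₁) :=
    hw.sub (continuous_const.mul (continuous_bump.comp (continuous_id.sub continuous_const)))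
  obtain ⟨x, -, hx⟩ := (isCompact_closedBall x₁ 1).exists_isMaxOn
    ⟨x₁, Metric.mem_closedBall_self zero_le_one⟩ hcont.continuousOn
  have hx1 : w x₁ ≤ w x - ε * bump (x - x₁) := by
    have := hx (Metric.mem_closedBall_self zero_le_one)
    simpa [hb0] using this
  have hmax : ∀ y, w y - ε * bump (y - x₁) ≤ w x - ε * bump (x - x₁) := fun y => by
    by_cases hy : y ∈ Metric.closedBall x₁ 1
    · exact hx hy
    · have hy' : 1 ≤ ‖y - x₁‖ := by
        rw [Metric.mem_closedBall, dist_eq_norm, not_le] at hy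
        exact hy.le
      nlinarith [half_le_bump hy', hsup y]
  refine ⟨x, by nlinarith [bump_nonneg (x - x₁)], fun z => ?_⟩
  have h1 := hmax (x + z)
  have h2 := hmax (x - z)
  have h3 := bump_second_difference_le (x - x₁) z
  rw [show x + z - x₁ = x - x₁ + z by abel] at h1
  rw [show x - z - x₁ = x - x₁ - z by abel] at h2
  nlinarith [mul_le_mul_of_nonneg_left h3 hε.le]

/-- Quantitative lower bound for the truncated nonlocal energy at an almost maximum point. -/
theorem le_setIntegral_second_difference {n : ℕ} (hn : 1 ≤ n) {s : ℝ}
    (hs : s ∈ Set.Ioo (0 : ℝ) 1) {D : En n → ℝ} (hD : Continuous D) {C : ℝ}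
    (hC : ∀ z, |D z| ≤ C) {ε m : ℝ} (hε : 0 ≤ ε) (hm : 0 ≤ m)
    (hlow : ∀ z, -(2 * ε * min 1 (‖z‖ ^ 2)) ≤ D z) {z₀ : En n} (hz₀ : 2 ≤ ‖z₀‖)
    (hball : ∀ z ∈ Metric.ball z₀ 1, m ≤ D z) {δ : ℝ} (hδ : 0 < δ) (hδ1 : δ ≤ 1) :
    m * (volume.real (Metric.ball z₀ 1) / (‖z₀‖ + 1) ^ ((n : ℝ) + 2 * s)) -
        2 * ε * ∫ z : En n, min 1 (‖z‖ ^ 2) / ‖z‖ ^ ((n : ℝ) + 2 * s) ≤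
      ∫ z in {z : En n | δ ≤ ‖z‖}, D z / ‖z‖ ^ ((n : ℝ) + 2 * s) := by
  have hp : 0 ≤ (n : ℝ) + 2 * s := by linarith [hs.1, Nat.cast_nonneg (α := ℝ) n]
  set p : ℝ := (n : ℝ) + 2 * s with hpdef
  set κ : ℝ := m / (‖z₀‖ + 1) ^ p with hκ
  have hK := integrable_min_one_norm_sq_div_rpow hn hs
  rw [← hpdef] at hK
  have hI : Integrable ((Metric.ball z₀ 1).indicator fun _ => κ) (volume : Measure (En n)) :=
    (integrable_indicator_iff Metric.isOpen_ball.measurableSet).2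
      (integrableOn_const (by exact measure_ball_lt_top.ne))
  have hsub : Metric.ball z₀ 1 ⊆ {z : En n | δ ≤ ‖z‖} := fun z hz => by
    have h1 : ‖z - z₀‖ < 1 := by simpa [dist_eq_norm] using hz
    have h2 : ‖z₀‖ ≤ ‖z‖ + ‖z - z₀‖ := by
      rw [norm_sub_rev]
      simpa using norm_add_le z (z₀ - z)
    show δ ≤ ‖z‖
    linarith
  have hle : ∫ z in {z : En n | δ ≤ ‖z‖}, ((Metric.ball z₀ 1).indicator (fun _ => κ) z -
      2 * ε * (min 1 (‖z‖ ^ 2) / ‖z‖ ^ p)) ≤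
      ∫ z in {z : En n | δ ≤ ‖z‖}, D z / ‖z‖ ^ p := by
    refine setIntegral_mono_on (hI.sub (hK.const_mul _)).integrableOn
      (integrableOn_div_rpow_norm hn hs hD hC hδ) (measurableSet_le_norm δ) fun z hz => ?_
    have hzpos : 0 < ‖z‖ := hδ.trans_le hz
    have hzp : 0 < ‖z‖ ^ p := Real.rpow_pos_of_pos hzpos _
    have hnn : 0 ≤ 2 * ε * (min 1 (‖z‖ ^ 2) / ‖z‖ ^ p) := by positivity
    by_cases hzB : z ∈ Metric.ball z₀ 1
    · rw [Set.indicator_of_mem hzB]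
      have h1 : ‖z - z₀‖ < 1 := by simpa [dist_eq_norm] using hzB
      have h2 : ‖z‖ ≤ ‖z₀‖ + 1 := by
        have := norm_add_le z₀ (z - z₀)
        rw [add_sub_cancel] at this
        linarith
      have h3 : κ ≤ D z / ‖z‖ ^ p :=
        div_le_div₀ (hm.trans (hball z hzB)) (hball z hzB) hzp
          (Real.rpow_le_rpow hzpos.le h2 hp)
      linarith
    · rw [Set.indicator_of_notMem hzB, zero_sub, ← mul_div_assoc, ← neg_div]
      exact div_le_div_of_nonneg_right (hlow z) hzp.le
  have hK2 : ∫ z in {z : En n | δ ≤ ‖z‖}, min 1 (‖z‖ ^ 2) / ‖z‖ ^ p ≤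
      ∫ z : En n, min 1 (‖z‖ ^ 2) / ‖z‖ ^ p :=
    setIntegral_le_integral hK (Eventually.of_forall fun z => by positivity)
  have hI2 : ∫ z in {z : En n | δ ≤ ‖z‖}, (Metric.ball z₀ 1).indicator (fun _ => κ) z =
      m * (volume.real (Metric.ball z₀ 1) / (‖z₀‖ + 1) ^ p) := by
    rw [setIntegral_indicator Metric.isOpen_ball.measurableSet,
      Set.inter_eq_right.2 hsub, setIntegral_const, smul_eq_mul, hκ]
    ring
  rw [integral_sub hI.integrableOn (hK.const_mul _).integrableOn, hI2,
    integral_const_mul] at hle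
  have := mul_le_mul_of_nonneg_left hK2 (mul_nonneg zero_le_two hε)
  linarith

theorem lap_sub_lap_add_le {n : ℕ} {u : En n → ℝ} (hu : ContDiff ℝ 2 u) (x a : En n) {C : ℝ}
    (h : ∀ z : En n, (u (x + z) - u (x + z + a)) + (u (x - z) - u (x - z + a)) -
      2 * (u x - u (x + a)) ≤ C * ‖z‖ ^ 2) :
    lap u x - lap u (x + a) ≤ n * C := by
  have hua : ContDiff ℝ 2 fun y => u (y + a) := hu.comp (contDiff_id.add contDiff_const)
  have hi : ∀ i : Fin n,
      iteratedFDeriv ℝ 2 u x (fun _ => EuclideanSpace.single i (1 : ℝ)) -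
        iteratedFDeriv ℝ 2 u (x + a) (fun _ => EuclideanSpace.single i (1 : ℝ)) ≤ C := by
    intro i
    have h1 := iteratedFDeriv_two_le_of_second_difference_le (hu.sub hua) x
      (EuclideanSpace.single i (1 : ℝ)) (C := C) fun t => by
        simpa [norm_smul] using h (t • EuclideanSpace.single i (1 : ℝ))
    have h2 : iteratedFDeriv ℝ 2 (fun y => u y - u (y + a)) x =
        iteratedFDeriv ℝ 2 u x - iteratedFDeriv ℝ 2 u (x + a) := by
      rw [← iteratedFDeriv_comp_add_right 2 a x]
      exact iteratedFDeriv_sub_apply (i := 2) hu.contDiffAt hua.contDiffAt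
    rw [h2] at h1
    simpa using h1
  unfold lap
  rw [← Finset.sum_sub_distrib]
  refine (Finset.sum_le_sum fun i _ => hi i).trans ?_
  simp

/-- A lower bound on the symmetric second differences of `u - u(· + a)` passes to the
difference of the fractional Laplacians. -/
theorem HasFracLap.le_sub {n : ℕ} (hn : 1 ≤ n) {s : ℝ} (hs : s ∈ Set.Ioo (0 : ℝ) 1)
    {Cns : ℝ} (hCns : 0 < Cns) {u : En n → ℝ} (hu : Continuous u) (hbd : ∀ x, |u x| ≤ 1)
    {x a : En n} {L L' : ℝ} (hL : HasFracLap n s Cns u x L)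
    (hL' : HasFracLap n s Cns u (x + a) L') {ε m : ℝ} (hε : 0 ≤ ε) (hm : 0 ≤ m)
    (hlow : ∀ z : En n, (u (x + z) - u (x + z + a)) + (u (x - z) - u (x - z + a)) -
      2 * (u x - u (x + a)) ≤ 2 * ε * min 1 (‖z‖ ^ 2)) {z₀ : En n} (hz₀ : 2 ≤ ‖z₀‖)
    (hball : ∀ z ∈ Metric.ball z₀ 1, m ≤ 2 * (u x - u (x + a)) -
      (u (x + z) - u (x + z + a)) - (u (x - z) - u (x - z + a))) :
    Cns / 2 * (m * (volume.real (Metric.ball z₀ 1) / (‖z₀‖ + 1) ^ ((n : ℝ) + 2 * s)) -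
        2 * ε * ∫ z : En n, min 1 (‖z‖ ^ 2) / ‖z‖ ^ ((n : ℝ) + 2 * s)) ≤ L - L' := by
  refine ge_of_tendsto (hL.sub hL') ?_
  filter_upwards [Ioo_mem_nhdsGT (zero_lt_one' ℝ)] with δ hδ
  have hDc : ∀ y, Continuous fun z => 2 * u y - u (y + z) - u (y - z) := fun y => by fun_prop
  have hDb : ∀ y z, |2 * u y - u (y + z) - u (y - z)| ≤ 4 := fun y z => by
    have h1 := abs_le.1 (hbd y)
    have h2 := abs_le.1 (hbd (y + z))
    have h3 := abs_le.1 (hbd (y - z))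
    rw [abs_le]
    constructor <;> linarith
  have key := le_setIntegral_second_difference hn hs
    (D := fun z => (2 * u x - u (x + z) - u (x - z)) -
      (2 * u (x + a) - u (x + a + z) - u (x + a - z)))
    ((hDc x).sub (hDc (x + a))) (C := 4 + 4)
    (fun z => (abs_sub _ _).trans (add_le_add (hDb x z) (hDb (x + a) z))) hε hm
    (fun z => by
      have := hlow z
      rw [show x + z + a = x + a + z by abel, show x - z + a = x + a - z by abel] at this
      linarith) hz₀
    (fun z hz => by
      have := hball z hz
      rw [show x + z + a = x + a + z by abel, show x - z + a = x + a - z by abel] at this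
      linarith) hδ.1 hδ.2.le
  simp only [sub_div (2 * u x - u _ - u _)] at key
  rw [integral_sub (integrableOn_div_rpow_norm hn hs (hDc x) (hDb x) hδ.1)
    (integrableOn_div_rpow_norm hn hs (hDc (x + a)) (hDb (x + a)) hδ.1),
    ← two_mul_truncated_integral hn hs hu hbd x hδ.1,
    ← two_mul_truncated_integral hn hs hu hbd (x + a) hδ.1] at key
  have := mul_le_mul_of_nonneg_left key (half_pos hCns).le
  linarith

theorem exists_pos_le_mul_lt {b N T : ℝ} (hb : 0 < b) (hN : 0 ≤ N) (hT : 0 < T) :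
    ∃ ε : ℝ, 0 < ε ∧ ε ≤ b ∧ ε * N < T := by
  have hN1 : 0 < N + 1 := by linarith
  have h0 : 0 < min b (T / (N + 1)) := lt_min hb (div_pos hT hN1)
  have h1 := min_le_right b (T / (N + 1))
  rw [le_div_iff₀ hN1] at h1
  exact ⟨_, h0, min_le_left _ _, by linarith⟩

/-- On a convex set where `|u|` is bounded below by a positive constant, a continuous `u` that is
positive somewhere is bounded below by that constant. -/
theorem le_of_le_abs_of_convex {n : ℕ} {u : En n → ℝ} (hu : Continuous u) {S : Set (En n)}
    (hS : Convex ℝ S) {c : ℝ} (hc : 0 < c) (habs : ∀ x ∈ S, c ≤ |u x|) {y : En n} (hy : y ∈ S)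
    (huy : 0 < u y) {x : En n} (hx : x ∈ S) : c ≤ u x := by
  rcases le_abs.1 (habs x hx) with h | h
  · exact h
  · obtain ⟨z, hz, hz0⟩ := hS.isPreconnected.intermediate_value hx hy hu.continuousOn
      (show (0 : ℝ) ∈ Set.Icc (u x) (u y) from ⟨by linarith, huy.le⟩)
    have := habs z hz
    rw [hz0, abs_zero] at this
    linarith

/-- Step 1 in the proof of the elliptic Gibbons theorem. -/
theorem gibbons_elliptic_step1
    (n : ℕ) (hn : 1 ≤ n) (i₀ : Fin n) (hi₀ : (i₀ : ℕ) = n - 1)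
    (s : ℝ) (hs : s ∈ Set.Ioo (0 : ℝ) 1) (Cns : ℝ) (hCns : 0 < Cns)
    (u : En n → ℝ) (huL : MemL2s n s u) (huC : ContDiff ℝ 2 u)
    (huu : UniformContinuous u)
    (g : En n → ℝ → ℝ) (hgc : Continuous fun p : En n × ℝ => g p.1 p.2)
    (Lu : En n → ℝ) (hLu : ∀ x, HasFracLap n s Cns u x (Lu x))
    (heq : ∀ x, Lu x - lap u x = g x (u x))
    (hbd : ∀ x, |u x| ≤ 1)
    (hlim : ∀ ε : ℝ, 0 < ε → ∃ A : ℝ, ∀ x : En n,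
      (A ≤ x i₀ → |u x - 1| < ε) ∧ (x i₀ ≤ -A → |u x + 1| < ε))
    (γ : ℝ) (hγ : 0 < γ)
    (hmono : ∀ x : En n, AntitoneOn (g x) (Set.Icc (-1) (-1 + γ)) ∧
      AntitoneOn (g x) (Set.Icc (1 - γ) 1))
    (hmonox : ∀ x y : En n, (∀ i, i ≠ i₀ → x i = y i) → x i₀ ≤ y i₀ →
      ∀ v : ℝ, g x v ≤ g y v)
    (lam : ℝ) (hlam : 0 < lam)
    (hlamprop : ∀ x : En n, lam ≤ |x i₀| → 1 - γ ≤ |u x|) :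
    ∀ τ : ℝ, 2 * lam ≤ τ → ∀ x : En n, u x ≤ u (x + τ • eDir i₀) := by

  intro τ hτ
  set a : En n := τ • eDir i₀ with ha
  have hai : ∀ y : En n, (y + a) i₀ = y i₀ + τ := fun y => by simp [ha, eDir]
  have haj : ∀ (y : En n) (i : Fin n), i ≠ i₀ → (y + a) i = y i := fun y i hi => by
    simp [ha, eDir, hi]
  have hτ0 : 0 < τ := by linarith
  have hcont : Continuous u := huC.continuous
  -- `u` is close to its limits outside the slab
  have hpos : γ < 1 → ∀ x : En n, lam ≤ x i₀ → 1 - γ ≤ u x := fun hγ1 x hx => by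
    obtain ⟨A, hA⟩ := hlim 1 one_pos
    refine le_of_le_abs_of_convex hcont (S := {y : En n | lam ≤ y i₀}) ?_ (by linarith)
      (fun y hy => hlamprop y (le_trans hy (le_abs_self _)))
      (y := (max A lam) • eDir i₀) (by simp [eDir]) ?_ hx
    · exact convex_halfSpace_ge (f := fun y : En n => y i₀) ⟨by simp, by simp⟩ lam
    · have := (hA ((max A lam) • eDir i₀)).1 (by simp [eDir])
      linarith [(abs_lt.1 this).1]
  have hneg : γ < 1 → ∀ x : En n, x i₀ ≤ -lam → u x ≤ -1 + γ := fun hγ1 x hx => by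
    obtain ⟨A, hA⟩ := hlim 1 one_pos
    have h := le_of_le_abs_of_convex (u := fun y => - u y) hcont.neg
      (S := {y : En n | y i₀ ≤ -lam}) ?_ (c := 1 - γ) (by linarith)
      (fun y hy => by
        rw [abs_neg]
        exact hlamprop y (le_abs.2 (Or.inr (le_neg_of_le_neg hy))))
      (y := (-(max A lam)) • eDir i₀) (by simp [eDir]) ?_ hx
    · linarith
    · exact convex_halfSpace_le (f := fun y : En n => y i₀) ⟨by simp, by simp⟩ (-lam)
    · have := (hA ((-(max A lam)) • eDir i₀)).2 (by simp [eDir])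
      linarith [(abs_lt.1 this).2]
  -- the nonlinearity has the right sign where `u` exceeds its translate
  have hsign : ∀ x, u (x + a) < u x → g x (u x) ≤ g (x + a) (u (x + a)) := fun x hx => by
    have b1 := abs_le.1 (hbd x)
    have b2 := abs_le.1 (hbd (x + a))
    have hshift : g x (u (x + a)) ≤ g (x + a) (u (x + a)) :=
      hmonox x (x + a) (fun i hi => (haj x i hi).symm) (by rw [hai]; linarith) _
    refine le_trans ?_ hshift
    by_cases h1 : 1 - γ ≤ u (x + a)
    · exact (hmono x).2 ⟨h1, b2.2⟩ ⟨by linarith, b1.2⟩ hx.le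
    by_cases h2 : u x ≤ -1 + γ
    · exact (hmono x).1 ⟨b2.1, by linarith⟩ ⟨b1.1, h2⟩ hx.le
    push Not at h1 h2
    by_cases hγ1 : γ < 1
    · rcases le_total (-lam) (x i₀) with h | h
      · exact absurd (hpos hγ1 (x + a) (by rw [hai]; linarith)) (not_le.2 h1)
      · exact absurd (hneg hγ1 x h) (not_le.2 h2)
    · push Not at hγ1
      have h3 : g x (u x) ≤ g x 0 := (hmono x).2 ⟨by linarith, by linarith⟩
        ⟨by linarith, b1.2⟩ (by linarith)
      have h4 : g x 0 ≤ g x (u (x + a)) := (hmono x).1 ⟨b2.1, by linarith⟩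
        ⟨by linarith, by linarith⟩ (by linarith)
      exact h3.trans h4
  by_contra! hcon
  obtain ⟨x₀, hx₀⟩ := hcon
  set w : En n → ℝ := fun y => u y - u (y + a) with hw
  have hwc : Continuous w := hcont.sub (hcont.comp (continuous_id.add continuous_const))
  have hbdd : BddAbove (Set.range w) := ⟨2, by
    rintro _ ⟨y, rfl⟩
    simp only [hw]
    linarith [(abs_le.1 (hbd y)).2, (abs_le.1 (hbd (y + a))).1]⟩
  set M : ℝ := sSup (Set.range w) with hM
  have hwM : ∀ y, w y ≤ M := fun y => le_csSup hbdd ⟨y, rfl⟩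
  have hM0 : 0 < M := lt_of_lt_of_le (sub_pos.2 hx₀) (hwM x₀)
  -- `w` is small away from a slab
  obtain ⟨A, hA⟩ := hlim (M / 4) (by linarith)
  set R : ℝ := |A| + τ with hR
  have hR0 : 0 < R := by positivity
  have hfar : ∀ y : En n, R ≤ |y i₀| → w y ≤ M / 2 := fun y hy => by
    simp only [hw]
    have hAabs := le_abs_self A
    rcases le_abs.1 hy with h | h
    · have h1 := abs_lt.1 ((hA y).1 (by linarith))
      have h2 := abs_lt.1 ((hA (y + a)).1 (by rw [hai]; linarith))
      linarith [h1.2, h2.1]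
    · have h1 := abs_lt.1 ((hA y).2 (by linarith))
      have h2 := abs_lt.1 ((hA (y + a)).2 (by rw [hai]; linarith))
      linarith [h1.2, h2.1]
  set z₀ : En n := (2 * R + 2) • eDir i₀ with hz₀
  have hz₀n : ‖z₀‖ = 2 * R + 2 := by
    rw [hz₀, norm_smul, eDir, PiLp.norm_single, norm_one, mul_one,
      Real.norm_of_nonneg (by linarith)]
  set c : ℝ := volume.real (Metric.ball z₀ 1) / (‖z₀‖ + 1) ^ ((n : ℝ) + 2 * s) with hc
  have hc0 : 0 < c := by
    refine div_pos (ENNReal.toReal_pos ?_ measure_ball_lt_top.ne)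
      (Real.rpow_pos_of_pos (by positivity) _)
    exact (Metric.measure_ball_pos _ _ one_pos).ne'
  set K : ℝ := ∫ z : En n, min 1 (‖z‖ ^ 2) / ‖z‖ ^ ((n : ℝ) + 2 * s) with hK
  have hK0 : 0 ≤ K := integral_nonneg fun z => by positivity
  obtain ⟨ε, hε0, hεM, hεs⟩ := exists_pos_le_mul_lt (b := M / 4) (N := Cns * K + 2 * n)
    (T := Cns / 2 * (M / 4 * c)) (by linarith)
    (add_nonneg (mul_nonneg hCns.le hK0) (by positivity))
    (mul_pos (half_pos hCns) (mul_pos (by linarith) hc0))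
  obtain ⟨x, hxM, hx2⟩ := exists_almost_max_second_difference_le hwc hbdd hε0
  rw [← hM] at hxM
  have hxR : |x i₀| < R := by
    by_contra! h
    linarith [hfar x h]
  have hfrac := HasFracLap.le_sub hn hs hCns hcont hbd (hLu x) (hLu (x + a)) hε0.le
    (m := M / 4) (by linarith) hx2 (z₀ := z₀) (by linarith) fun z hz => by
      have h1 : ‖z - z₀‖ < 1 := by simpa [dist_eq_norm] using hz
      have h2 : |z i₀ - z₀ i₀| ≤ ‖z - z₀‖ := by
        simpa using PiLp.norm_apply_le (z - z₀) i₀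
      have h3 : z₀ i₀ = 2 * R + 2 := by simp [hz₀, eDir]
      rw [h3] at h2
      have h4 := hfar (x + z) (by
        refine le_trans ?_ (le_abs_self _)
        rw [PiLp.add_apply]
        linarith [(abs_lt.1 hxR).1, (abs_le.1 h2).1])
      have h5 := hwM (x - z)
      simp only [hw] at h4 h5 hxM
      linarith
  have hlap := lap_sub_lap_add_le huC x a (C := 2 * ε) fun z =>
    (hx2 z).trans (mul_le_mul_of_nonneg_left (min_le_right _ _) (by linarith))
  have hs' := hsign x (sub_pos.1 (show 0 < w x by linarith))
  rw [← heq, ← heq] at hs'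
  nlinarith
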